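/- arXiv:math/0610011 — 2 statements merged into one kernel-verified Lean document; each statement's English description precedes it below -/
import Mathlib

section
/- There exists a constant C > 0 such that for every nonnegative f ∈ L¹(λ) and every η > 0, λ({x ∈ (0,∞) : T*_{μ,+} f(x) > η}) ≤ (C/η) ∫_ℝ |f| dλ. -/
open MeasureTheory Real Set

/-- The measure dλ(x) = |x|^{2μ} e^{-x²} dx on ℝ. -/
noncomputable def lam (μ : ℝ) : Measure ℝ :=
  volume.withDensity (fun x => ENNReal.ofReal (|x| ^ (2 * μ) * Real.exp (-x ^ 2)))

/-- The generalized factorial γ_μ: γ_μ(2m) = 2^{2m} m! Γ(m+μ+1/2)/Γ(μ+1/2),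
γ_μ(2m+1) = 2^{2m+1} m! Γ(m+μ+3/2)/Γ(μ+1/2). -/
noncomputable def genGamma (μ : ℝ) (n : ℕ) : ℝ :=
  if Even n then
    2 ^ n * (Nat.factorial (n / 2)) * Real.Gamma (((n / 2 : ℕ) : ℝ) + μ + 1 / 2) /
      Real.Gamma (μ + 1 / 2)
  else
    2 ^ n * (Nat.factorial (n / 2)) * Real.Gamma (((n / 2 : ℕ) : ℝ) + μ + 3 / 2) /
      Real.Gamma (μ + 1 / 2)

/-- The generalized exponential function e_μ(x) = Σ_{m} x^m / γ_μ(m). -/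
noncomputable def genExp (μ : ℝ) (x : ℝ) : ℝ := ∑' m : ℕ, x ^ m / genGamma μ m

/-- The half-line operator
T^r_{μ,+} f(x) = (1-r²)^{-(μ+1/2)} ∫_0^∞ e^{-(x²+y²)r²/(1-r²)} e_μ(2xyr/(1-r²)) f(y) y^{2μ} e^{-y²} dy. -/
noncomputable def Tplus (μ r : ℝ) (f : ℝ → ℝ) (x : ℝ) : ℝ :=
  ((1 - r ^ 2) ^ (μ + 1 / 2))⁻¹ *
    ∫ y in Set.Ioi (0 : ℝ),
      Real.exp (-(x ^ 2 + y ^ 2) * r ^ 2 / (1 - r ^ 2)) *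
        genExp μ (2 * x * y * r / (1 - r ^ 2)) * f y * y ^ (2 * μ) * Real.exp (-y ^ 2)

/-- T*_{μ,+} f(x) = sup_{0<r<1} |T^r_{μ,+} f(x)|. -/
noncomputable def TstarPlus (μ : ℝ) (f : ℝ → ℝ) (x : ℝ) : ℝ :=
  ⨆ r : Set.Ioo (0 : ℝ) 1, |Tplus μ (r : ℝ) f x|


/-- A finite family of open intervals has a subfamily with the same union
in which every point lies in at most two intervals. -/
lemma exists_subfamily_overlap_le_two (S : Finset (ℝ × ℝ)) :
    ∃ T : Finset (ℝ × ℝ), T ⊆ S ∧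
      (⋃ i ∈ S, Ioo i.1 i.2) ⊆ ⋃ i ∈ T, Ioo i.1 i.2 ∧
      ∀ x : ℝ, (T.filter (fun i => x ∈ Ioo i.1 i.2)).card ≤ 2 := by
  classical
  induction S using Finset.strongInduction with
  | H S ih =>
    by_cases h : ∀ x : ℝ, (S.filter (fun i => x ∈ Ioo i.1 i.2)).card ≤ 2
    · exact ⟨S, subset_rfl, subset_rfl, h⟩
    push Not at h
    obtain ⟨x, hx⟩ := h
    set G := S.filter (fun i => x ∈ Ioo i.1 i.2) with hG
    have hne : G.Nonempty := Finset.card_pos.mp (by omega)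
    obtain ⟨A, hA, hAmin⟩ := G.exists_min_image Prod.fst hne
    obtain ⟨B, hB, hBmax⟩ := G.exists_max_image Prod.snd hne
    obtain ⟨D, hD, hDn⟩ : ∃ D ∈ G, D ∉ ({A, B} : Finset (ℝ × ℝ)) := by
      by_contra! hcon
      have h1 := Finset.card_le_card (show G ⊆ {A, B} from hcon)
      have h2 := Finset.card_le_two (a := A) (b := B)
      omega
    simp only [Finset.mem_insert, Finset.mem_singleton, not_or] at hDn
    have hDmin := hAmin D hD
    have hDmax := hBmax D hD
    simp only [hG, Finset.mem_filter, mem_Ioo] at hA hB hD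
    obtain ⟨T, hTS, hTu, hT⟩ := ih (S.erase D) (Finset.erase_ssubset hD.1)
    refine ⟨T, hTS.trans (Finset.erase_subset _ _), ?_, hT⟩
    refine subset_trans ?_ hTu
    intro y hy
    simp only [mem_iUnion, exists_prop] at hy ⊢
    obtain ⟨i, hi, hyi⟩ := hy
    by_cases hiD : i = D
    · subst hiD
      rcases le_total y x with hyx | hyx
      · exact ⟨A, Finset.mem_erase.mpr ⟨Ne.symm hDn.1, hA.1⟩,
          lt_of_le_of_lt hDmin hyi.1, lt_of_le_of_lt hyx hA.2.2⟩
      · exact ⟨B, Finset.mem_erase.mpr ⟨Ne.symm hDn.2, hB.1⟩,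
          lt_of_lt_of_le hB.2.1 hyx, lt_of_lt_of_le hyi.2 hDmax⟩
    · exact ⟨i, Finset.mem_erase.mpr ⟨hiD, hi⟩, hyi⟩

lemma mul_measure_biUnion_Ioo_le (ν σ : Measure ℝ) (t : ENNReal) (S : Finset (ℝ × ℝ))
    (hS : ∀ i ∈ S, t * ν (Ioo i.1 i.2) ≤ σ (Ioo i.1 i.2)) :
    t * ν (⋃ i ∈ S, Ioo i.1 i.2) ≤ 2 * σ univ := by
  classical
  obtain ⟨T, hTS, hTu, hT⟩ := exists_subfamily_overlap_le_two S
  calc t * ν (⋃ i ∈ S, Ioo i.1 i.2)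
      ≤ t * ∑ i ∈ T, ν (Ioo i.1 i.2) := by
        gcongr
        exact (measure_mono hTu).trans (measure_biUnion_finset_le _ _)
    _ ≤ ∑ i ∈ T, σ (Ioo i.1 i.2) := by
        rw [Finset.mul_sum]
        exact Finset.sum_le_sum fun i hi => hS i (hTS hi)
    _ = ∫⁻ x, ∑ i ∈ T, (Ioo i.1 i.2).indicator (fun _ => (1 : ENNReal)) x ∂σ := by
        rw [lintegral_finsetSum]
        · exact Finset.sum_congr rfl fun i _ => by
            rw [lintegral_indicator measurableSet_Ioo]; simp
        · exact fun i _ => measurable_const.indicator measurableSet_Ioo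
    _ ≤ ∫⁻ _, 2 ∂σ := by
        refine lintegral_mono fun x => ?_
        have : ∑ i ∈ T, (Ioo i.1 i.2).indicator (fun _ => (1 : ENNReal)) x
            = ((T.filter (fun i => x ∈ Ioo i.1 i.2)).card : ENNReal) := by
          simp [indicator_apply]
        rw [this]
        exact (Nat.cast_le.mpr (hT x)).trans (by norm_num)
    _ = 2 * σ univ := by simp

/-- The set of points lying in an open interval whose `σ`-measure exceeds `t` times its
`ν`-measure. -/
def largeDensitySet (ν σ : Measure ℝ) (t : ENNReal) : Set ℝ :=
  ⋃ i ∈ {i : ℝ × ℝ | t * ν (Ioo i.1 i.2) < σ (Ioo i.1 i.2)}, Ioo i.1 i.2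

lemma mul_measure_largeDensitySet_le (ν σ : Measure ℝ) [IsFiniteMeasure ν] (t : ENNReal) :
    t * ν (largeDensitySet ν σ t) ≤ 2 * σ univ := by
  have hopen : IsOpen (largeDensitySet ν σ t) := isOpen_biUnion fun i _ => isOpen_Ioo
  rw [hopen.measure_eq_iSup_isCompact]
  simp only [ENNReal.mul_iSup]
  refine iSup₂_le fun K hKV => iSup_le fun hK => ?_
  obtain ⟨b, hb, hbf, hKb⟩ := hK.elim_finite_subcover_image
    (fun i (_ : i ∈ {i : ℝ × ℝ | t * ν (Ioo i.1 i.2) < σ (Ioo i.1 i.2)}) =>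
      (isOpen_Ioo : IsOpen (Ioo i.1 i.2))) hKV
  refine le_trans ?_ (mul_measure_biUnion_Ioo_le ν σ t hbf.toFinset
    fun i hi => (hb (hbf.mem_toFinset.mp hi)).le)
  gcongr
  simpa using hKb

lemma measure_Icc_le_of_notMem_largeDensitySet {ν σ : Measure ℝ} [IsFiniteMeasure ν]
    {t : ENNReal} (ht : t ≠ ⊤) {x : ℝ} (hx : x ∉ largeDensitySet ν σ t) {c d : ℝ}
    (hc : c ≤ x) (hd : x ≤ d) : σ (Icc c d) ≤ t * ν (Icc c d) := by
  have key : ∀ n : ℕ, σ (Icc c d) ≤ t * ν (Ioo (c - 1 / ((n : ℝ) + 1)) (d + 1 / ((n : ℝ) + 1))) := by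
    intro n
    have hn : (0 : ℝ) < 1 / ((n : ℝ) + 1) := by positivity
    refine (measure_mono (Icc_subset_Ioo (sub_lt_self c hn) (lt_add_of_pos_right d hn))).trans ?_
    by_contra! hcon
    exact hx (mem_biUnion (x := (c - 1 / ((n : ℝ) + 1), d + 1 / ((n : ℝ) + 1))) hcon
      ⟨by dsimp only; linarith, by dsimp only; linarith⟩)
  have hanti : Antitone fun n : ℕ => Ioo (c - 1 / ((n : ℝ) + 1)) (d + 1 / ((n : ℝ) + 1)) := by
    intro m n hmn
    have := Nat.one_div_le_one_div (α := ℝ) hmn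
    exact Ioo_subset_Ioo (by linarith) (by linarith)
  have hlim := tendsto_measure_iInter_atTop (μ := ν)
    (fun n => (measurableSet_Ioo.nullMeasurableSet)) hanti ⟨0, measure_ne_top _ _⟩
  have hinter : ⋂ n : ℕ, Ioo (c - 1 / ((n : ℝ) + 1)) (d + 1 / ((n : ℝ) + 1)) = Icc c d := by
    refine subset_antisymm (fun y hy => ?_) (subset_iInter fun n => ?_)
    · simp only [mem_iInter, mem_Ioo] at hy
      constructor
      · refine le_of_forall_pos_le_add fun ε hε => ?_
        obtain ⟨n, hn⟩ := exists_nat_one_div_lt hε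
        linarith [(hy n).1]
      · refine le_of_forall_pos_le_add fun ε hε => ?_
        obtain ⟨n, hn⟩ := exists_nat_one_div_lt hε
        linarith [(hy n).2]
    · have hn : (0 : ℝ) < 1 / ((n : ℝ) + 1) := by positivity
      exact Icc_subset_Ioo (sub_lt_self c hn) (lt_add_of_pos_right d hn)
  rw [hinter] at hlim
  exact ge_of_tendsto' (ENNReal.Tendsto.const_mul hlim (Or.inr ht)) key

lemma measure_le_of_notMem_largeDensitySet {ν σ : Measure ℝ} [IsFiniteMeasure ν]
    [IsFiniteMeasure σ] {t : ENNReal} (ht : t ≠ ⊤) {x : ℝ} (hx : x ∉ largeDensitySet ν σ t)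
    {J : Set ℝ} (hJ : J.OrdConnected) (hxJ : x ∈ J) : σ J ≤ t * ν J := by
  rw [hJ.measurableSet.measure_eq_iSup_isCompact]
  refine iSup₂_le fun K hKJ => iSup_le fun hK => ?_
  have hK' : IsCompact (insert x K) := hK.insert x
  have hne : (insert x K).Nonempty := insert_nonempty x K
  have hsub : insert x K ⊆ J := insert_subset hxJ hKJ
  have hxK := mem_insert x K
  have hIcc : Icc (sInf (insert x K)) (sSup (insert x K)) ⊆ J :=
    hJ.out (hsub (hK'.sInf_mem hne)) (hsub (hK'.sSup_mem hne))
  have hKI : K ⊆ Icc (sInf (insert x K)) (sSup (insert x K)) := fun y hy =>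
    ⟨csInf_le hK'.bddBelow (mem_insert_of_mem x hy), le_csSup hK'.bddAbove (mem_insert_of_mem x hy)⟩
  calc σ K ≤ σ (Icc (sInf (insert x K)) (sSup (insert x K))) := measure_mono hKI
    _ ≤ t * ν (Icc (sInf (insert x K)) (sSup (insert x K))) :=
      measure_Icc_le_of_notMem_largeDensitySet ht hx (csInf_le hK'.bddBelow hxK)
        (le_csSup hK'.bddAbove hxK)
    _ ≤ t * ν J := by gcongr

/-- Integrals of a quasiconcave function against `σ` are controlled by its integral against `ν`
when `σ` is dominated by `t • ν` on intervals containing `x`, provided `ν` does not charge too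
much the interval between `x` and an almost maximum point. -/
lemma lintegral_quasiconcave_le {ν σ : Measure ℝ} {t : ENNReal} {x : ℝ}
    (hJ : ∀ J : Set ℝ, J.OrdConnected → x ∈ J → σ J ≤ t * ν J) {g : ℝ → ℝ}
    (hgm : Measurable g) (hg0 : ∀ y, 0 ≤ g y)
    (hgq : ∀ a b c, a ≤ b → b ≤ c → min (g a) (g c) ≤ g b)
    {p : ℝ} (hp : ∀ y, g y ≤ 2 * g p) {B : ENNReal}
    (hB : ENNReal.ofReal (g p) * ν (uIcc x p) ≤ B)
    (hgB : ∫⁻ y, ENNReal.ofReal (g y) ∂ν ≤ B) :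
    ∫⁻ y, ENNReal.ofReal (g y) ∂σ ≤ 4 * t * B := by
  have hbound : ∀ s ∈ Ioi (0 : ℝ), σ {y | s < min (g y) (g p)} ≤
      t * (ν {y | s < g y} + (Ioo 0 (g p)).indicator (fun _ => ν (uIcc x p)) s) := by
    intro s hs
    by_cases hsp : s < g p
    · have hoc : ({y | s < g y} ∪ uIcc x p).OrdConnected := by
        have h1 : ({y | s < g y}).OrdConnected :=
          ⟨fun a ha c hc b hb => lt_of_lt_of_le (lt_min ha hc) (hgq a b c hb.1 hb.2)⟩
        have h2 := h1.isPreconnected.union p (t := uIcc x p) hsp right_mem_uIcc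
          isPreconnected_uIcc
        exact h2.ordConnected
      have h := hJ _ hoc (Or.inr left_mem_uIcc)
      rw [indicator_of_mem (show s ∈ Ioo 0 (g p) from ⟨hs, hsp⟩)]
      calc σ {y | s < min (g y) (g p)} ≤ σ ({y | s < g y} ∪ uIcc x p) :=
            measure_mono fun y (hy : s < min (g y) (g p)) =>
              Or.inl (show s < g y from hy.trans_le (min_le_left _ _))
        _ ≤ t * ν ({y | s < g y} ∪ uIcc x p) := h
        _ ≤ _ := by gcongr; exact measure_union_le _ _
    · have : {y | s < min (g y) (g p)} = ∅ := by
        ext y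
        simp only [mem_ofPred_eq, mem_empty_iff_false, iff_false, not_lt]
        exact (min_le_right _ _).trans (not_lt.mp hsp)
      rw [this, measure_empty]
      exact zero_le
  have hmono : ∀ m : Measure ℝ, Measurable fun s : ℝ => m {y | s < g y} := fun m =>
    Antitone.measurable fun s s' h => measure_mono fun y hy => lt_of_le_of_lt h hy
  have hσ : ∫⁻ y, ENNReal.ofReal (min (g y) (g p)) ∂σ ≤ t * (B + B) := by
    rw [lintegral_eq_lintegral_meas_lt σ
      (Filter.Eventually.of_forall fun y => le_min (hg0 y) (hg0 p))
      (hgm.min measurable_const).aemeasurable]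
    calc _ ≤ ∫⁻ s in Ioi (0 : ℝ),
          t * (ν {y | s < g y} + (Ioo 0 (g p)).indicator (fun _ => ν (uIcc x p)) s) :=
          setLIntegral_mono' measurableSet_Ioi hbound
      _ = t * ((∫⁻ s in Ioi (0 : ℝ), ν {y | s < g y}) +
            ∫⁻ s in Ioi (0 : ℝ), (Ioo 0 (g p)).indicator (fun _ => ν (uIcc x p)) s) := by
          rw [← lintegral_add_left (hmono ν)]
          exact lintegral_const_mul _ ((hmono ν).add
            (measurable_const.indicator measurableSet_Ioo))
      _ ≤ t * (B + B) := by
          gcongr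
          · rw [← lintegral_eq_lintegral_meas_lt ν (Filter.Eventually.of_forall hg0)
              hgm.aemeasurable]
            exact hgB
          · rw [lintegral_indicator measurableSet_Ioo, Measure.restrict_restrict measurableSet_Ioo,
              inter_eq_left.mpr Ioo_subset_Ioi_self, setLIntegral_const, Real.volume_Ioo, sub_zero,
              mul_comm]
            exact hB
  calc ∫⁻ y, ENNReal.ofReal (g y) ∂σ
      ≤ ∫⁻ y, 2 * ENNReal.ofReal (min (g y) (g p)) ∂σ := by
        refine lintegral_mono fun y => ?_
        rw [← ENNReal.ofReal_ofNat, ← ENNReal.ofReal_mul (by norm_num)]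
        refine ENNReal.ofReal_le_ofReal ?_
        rcases min_cases (g y) (g p) with h | h
        · rw [h.1]; linarith [hg0 y]
        · rw [h.1]; exact hp y
    _ = 2 * ∫⁻ y, ENNReal.ofReal (min (g y) (g p)) ∂σ :=
        lintegral_const_mul _ (hgm.min measurable_const).ennreal_ofReal
    _ ≤ 2 * (t * (B + B)) := by gcongr
    _ = 4 * t * B := by ring


/-- The coefficient `Γ(a) / (m! Γ(m + a))` of the hypergeometric series `₀F₁(; a; ·)`. -/
noncomputable def hypCoeff (a : ℝ) (m : ℕ) : ℝ :=
  Gamma a / (Nat.factorial m * Gamma (m + a))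

/-- The hypergeometric function `₀F₁(; a; ·)`. -/
noncomputable def hyp (a w : ℝ) : ℝ := ∑' m : ℕ, hypCoeff a m * w ^ m

section hyp

variable {a : ℝ}

lemma hypCoeff_pos (ha : 0 < a) (m : ℕ) : 0 < hypCoeff a m := by
  have := Gamma_pos_of_pos ha
  have := Gamma_pos_of_pos (show 0 < (m : ℝ) + a by positivity)
  unfold hypCoeff
  positivity

lemma hypCoeff_zero (ha : 0 < a) : hypCoeff a 0 = 1 := by
  have := Gamma_pos_of_pos ha
  simp [hypCoeff, this.ne']

lemma hypCoeff_succ (ha : 0 < a) (m : ℕ) :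
    hypCoeff a (m + 1) = hypCoeff a m / ((m + 1) * (m + a)) := by
  have h1 : (0 : ℝ) < m + a := by positivity
  have h2 := Gamma_pos_of_pos h1
  have h3 : Gamma (((m + 1 : ℕ) : ℝ) + a) = (m + a) * Gamma (m + a) := by
    rw [← Gamma_add_one h1.ne']; push_cast; ring_nf
  unfold hypCoeff
  rw [h3, Nat.factorial_succ]
  push_cast
  field_simp

lemma succ_le_mul_add (ha : 0 < a) (m : ℕ) : (m : ℝ) + 1 ≤ (1 + 1 / a) * (m + a) := by
  have : (1 + 1 / a) * (m + a) = m + 1 + a + m / a := by field_simp; ring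
  rw [this]
  have : 0 ≤ (m : ℝ) / a := by positivity
  linarith

lemma hypCoeff_le (ha : 0 < a) (m : ℕ) :
    hypCoeff a m ≤ (1 + 1 / a) ^ m / (Nat.factorial m) ^ 2 := by
  induction m with
  | zero => simp [hypCoeff_zero ha]
  | succ m ih =>
    have h0 : (0 : ℝ) < m + a := by positivity
    rw [hypCoeff_succ ha, Nat.factorial_succ]
    push_cast
    have h1 : 1 / ((m : ℝ) + a) ≤ (1 + 1 / a) / (m + 1) := by
      rw [div_le_div_iff₀ h0 (by positivity), one_mul]
      exact succ_le_mul_add ha m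
    calc hypCoeff a m / (((m : ℝ) + 1) * (m + a))
        = hypCoeff a m * (1 / ((m : ℝ) + a)) / (m + 1) := by field_simp
      _ ≤ ((1 + 1 / a) ^ m / (Nat.factorial m) ^ 2) * ((1 + 1 / a) / (m + 1)) / (m + 1) := by
        gcongr
      _ = _ := by rw [pow_succ (1 + 1 / a)]; field_simp

lemma hypCoeff_mul_pow_le (ha : 0 < a) {N w : ℝ} (hN : 0 < N) (hw : 0 ≤ w) (m : ℕ) :
    hypCoeff a m * w ^ m ≤ exp ((1 + 1 / a) * N) * ((w / N) ^ m / Nat.factorial m) := by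
  calc hypCoeff a m * w ^ m ≤ ((1 + 1 / a) ^ m / (Nat.factorial m) ^ 2) * w ^ m := by
        gcongr; exact hypCoeff_le ha m
    _ = (((1 + 1 / a) * N) ^ m / Nat.factorial m) * ((w / N) ^ m / Nat.factorial m) := by
        rw [mul_pow, div_pow]; field_simp
    _ ≤ _ := by
        gcongr
        exact pow_div_factorial_le_exp _ (by positivity) m

lemma summable_hyp_of_nonneg (ha : 0 < a) {w : ℝ} (hw : 0 ≤ w) :
    Summable fun m : ℕ => hypCoeff a m * w ^ m :=
  Summable.of_nonneg_of_le (fun m => mul_nonneg (hypCoeff_pos ha m).le (pow_nonneg hw m))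
    (fun m => hypCoeff_mul_pow_le ha one_pos hw m)
    ((summable_pow_div_factorial _).mul_left _)

lemma hyp_pos (ha : 0 < a) {w : ℝ} (hw : 0 ≤ w) : 0 < hyp a w :=
  (summable_hyp_of_nonneg ha hw).tsum_pos
    (fun m => mul_nonneg (hypCoeff_pos ha m).le (pow_nonneg hw m)) 0
    (by simp [hypCoeff_zero ha])

lemma hyp_le (ha : 0 < a) {N w : ℝ} (hN : 0 < N) (hw : 0 ≤ w) :
    hyp a w ≤ exp ((1 + 1 / a) * N) * exp (w / N) := by
  have h : HasSum (fun m : ℕ => (w / N) ^ m / Nat.factorial m) (exp (w / N)) := by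
    rw [exp_eq_exp_ℝ]
    exact NormedSpace.expSeries_div_hasSum_exp (w / N)
  exact hasSum_le (fun m => hypCoeff_mul_pow_le ha hN hw m)
    (summable_hyp_of_nonneg ha hw).hasSum (h.mul_left _)

/-- The termwise derivative of `hyp a`. -/
noncomputable def hypDeriv (a w : ℝ) : ℝ := ∑' m : ℕ, hypCoeff a m / (m + a) * w ^ m

lemma summable_hypDeriv_of_nonneg (ha : 0 < a) {w : ℝ} (hw : 0 ≤ w) :
    Summable fun m : ℕ => hypCoeff a m / (m + a) * w ^ m := by
  refine Summable.of_nonneg_of_le (fun m => ?_) (fun m => ?_)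
    ((summable_hyp_of_nonneg ha hw).mul_left (1 / a))
  · have := hypCoeff_pos ha m
    positivity
  · have := hypCoeff_pos ha m
    have h1 : 1 / ((m : ℝ) + a) ≤ 1 / a := by
      gcongr
      linarith [(Nat.cast_nonneg m : (0 : ℝ) ≤ m)]
    calc hypCoeff a m / (m + a) * w ^ m = 1 / ((m : ℝ) + a) * (hypCoeff a m * w ^ m) := by ring
      _ ≤ _ := by gcongr

lemma hasDerivAt_hyp (ha : 0 < a) (w : ℝ) : HasDerivAt (hyp a) (hypDeriv a w) w := by
  set R : ℝ := |w| + 1 with hR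
  have hR0 : 0 < R := by positivity
  have hcoef : ∀ m : ℕ, hypCoeff a (m + 1) * ((m + 1 : ℕ) : ℝ) = hypCoeff a m / (m + a) := by
    intro m
    have : (0 : ℝ) < m + a := by positivity
    rw [hypCoeff_succ ha]; push_cast; field_simp
  have hterm : ∀ (v : ℝ) (m : ℕ), hypCoeff a (m + 1) * (((m + 1 : ℕ) : ℝ) * v ^ (m + 1 - 1)) =
      hypCoeff a m / (m + a) * v ^ m := by
    intro v m
    rw [← mul_assoc, hcoef, Nat.add_sub_cancel]
  have hu : Summable fun m : ℕ => hypCoeff a m * ((m : ℝ) * R ^ (m - 1)) := by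
    rw [← summable_nat_add_iff 1]
    simp only [hterm]
    exact summable_hypDeriv_of_nonneg ha hR0.le
  have hball : ∀ v ∈ Metric.ball (0 : ℝ) R, ∀ m : ℕ,
      ‖hypCoeff a m * ((m : ℝ) * v ^ (m - 1))‖ ≤ hypCoeff a m * ((m : ℝ) * R ^ (m - 1)) := by
    intro v hv m
    have hv' : |v| ≤ R := by simpa using (Metric.mem_ball.mp hv).le
    have := (hypCoeff_pos ha m).le
    rw [norm_mul, norm_mul, norm_pow, norm_of_nonneg this, norm_of_nonneg (Nat.cast_nonneg m),
      norm_eq_abs]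
    gcongr
  have hwm : w ∈ Metric.ball (0 : ℝ) R := by simp [hR]
  have h := hasDerivAt_tsum_of_isPreconnected hu Metric.isOpen_ball
    (convex_ball (0 : ℝ) R).isPreconnected
    (g := fun m v => hypCoeff a m * v ^ m) (g' := fun m v => hypCoeff a m * ((m : ℝ) * v ^ (m - 1)))
    (fun m v _ => (hasDerivAt_pow m v).const_mul _) (fun m v hv => hball v hv m)
    (Metric.mem_ball_self hR0) (summable_hyp_of_nonneg ha le_rfl) hwm
  have e : ∑' m : ℕ, hypCoeff a m * ((m : ℝ) * w ^ (m - 1)) = hypDeriv a w := by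
    rw [(Summable.of_norm_bounded hu (hball w hwm)).tsum_eq_zero_add]
    simp only [hterm, hypDeriv]
    simp
  rw [e] at h
  exact h

lemma continuous_hyp (ha : 0 < a) : Continuous (hyp a) :=
  continuous_iff_continuousAt.mpr fun w => (hasDerivAt_hyp ha w).continuousAt

/-- The quotient of two power series is antitone when the quotients of coefficients are. -/
lemma hypDeriv_mul_hyp_le (ha : 0 < a) {w w' : ℝ} (hw : 0 ≤ w) (hww' : w ≤ w') :
    hypDeriv a w' * hyp a w ≤ hypDeriv a w * hyp a w' := by
  have hw' := hw.trans hww'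
  have habs : ∀ {f : ℕ → ℝ}, Summable f → Summable fun n => ‖f n‖ := fun h => h.norm
  have s1 := summable_mul_of_summable_norm (habs (summable_hypDeriv_of_nonneg ha hw'))
    (habs (summable_hyp_of_nonneg ha hw))
  have s2 := summable_mul_of_summable_norm (habs (summable_hypDeriv_of_nonneg ha hw))
    (habs (summable_hyp_of_nonneg ha hw'))
  have e1 := tsum_mul_tsum_of_summable_norm (habs (summable_hypDeriv_of_nonneg ha hw'))
    (habs (summable_hyp_of_nonneg ha hw))
  have e2 := tsum_mul_tsum_of_summable_norm (habs (summable_hypDeriv_of_nonneg ha hw))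
    (habs (summable_hyp_of_nonneg ha hw'))
  have h1 := s1.hasSum.add ((Equiv.prodComm ℕ ℕ).hasSum_iff.mpr s1.hasSum)
  have h2 := s2.hasSum.add ((Equiv.prodComm ℕ ℕ).hasSum_iff.mpr s2.hasSum)
  rw [← e1] at h1
  rw [← e2] at h2
  have key := hasSum_le (fun z : ℕ × ℕ => ?_) h1 h2
  · unfold hypDeriv hyp
    linarith
  obtain ⟨m, n⟩ := z
  simp only [Function.comp, Equiv.prodComm_apply, Prod.swap]
  wlog hmn : m ≤ n generalizing m n
  · have := this n m (le_of_not_ge hmn)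
    linarith
  have hm := hypCoeff_pos ha m
  have hn := hypCoeff_pos ha n
  have hmn' : (m : ℝ) ≤ n := by exact_mod_cast hmn
  have hma : (0 : ℝ) < m + a := by positivity
  have hd : 1 / ((n : ℝ) + a) ≤ 1 / (m + a) := by gcongr
  have hp : w' ^ m * w ^ n ≤ w ^ m * w' ^ n := by
    obtain ⟨k, rfl⟩ := Nat.exists_eq_add_of_le hmn
    rw [pow_add, pow_add]
    have : w ^ k ≤ w' ^ k := by gcongr
    nlinarith [mul_le_mul_of_nonneg_left this (mul_nonneg (pow_nonneg hw m) (pow_nonneg hw' m))]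
  have := mul_nonneg (mul_nonneg hm.le hn.le) (mul_nonneg (sub_nonneg.mpr hd) (sub_nonneg.mpr hp))
  have e : hypCoeff a m * hypCoeff a n * ((1 / ((m : ℝ) + a) - 1 / (n + a)) *
      (w ^ m * w' ^ n - w' ^ m * w ^ n)) =
    (hypCoeff a m / (m + a) * w ^ m * (hypCoeff a n * w' ^ n) +
      hypCoeff a n / (n + a) * w ^ n * (hypCoeff a m * w' ^ m)) -
    (hypCoeff a m / (m + a) * w' ^ m * (hypCoeff a n * w ^ n) +
      hypCoeff a n / (n + a) * w' ^ n * (hypCoeff a m * w ^ m)) := by ring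
  linarith

lemma concaveOn_log_hyp (ha : 0 < a) : ConcaveOn ℝ (Ici 0) fun w => log (hyp a w) := by
  have hd : ∀ w : ℝ, 0 ≤ w → HasDerivAt (fun w => log (hyp a w)) (hypDeriv a w / hyp a w) w :=
    fun w hw => (hasDerivAt_hyp ha w).log (hyp_pos ha hw).ne'
  refine AntitoneOn.concaveOn_of_deriv (convex_Ici 0)
    (fun w hw => (hd w hw).continuousAt.continuousWithinAt) ?_ ?_
  · intro w hw
    exact (hd w (interior_subset hw)).differentiableAt.differentiableWithinAt
  · intro w hw w' hw' hww'
    have hw := interior_subset hw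
    have hw' := interior_subset hw'
    rw [(hd w hw).deriv, (hd w' hw').deriv,
      div_le_div_iff₀ (hyp_pos ha hw') (hyp_pos ha hw)]
    exact hypDeriv_mul_hyp_le ha hw hww'

end hyp

/-- The kernel of the half-line operators, with the generalized exponential replaced by its
even part. -/
noncomputable def evenKernel (a r x y : ℝ) : ℝ :=
  ((1 - r ^ 2) ^ a)⁻¹ * exp (-(x ^ 2 + y ^ 2) * r ^ 2 / (1 - r ^ 2)) *
    hyp a ((x * y * r / (1 - r ^ 2)) ^ 2)

section evenKernel

variable {a r : ℝ}

lemma evenKernel_comm (a r x y : ℝ) : evenKernel a r x y = evenKernel a r y x := by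
  unfold evenKernel
  rw [add_comm, mul_comm x y]

lemma one_sub_sq_pos (hr : r ∈ Ioo (0 : ℝ) 1) : 0 < 1 - r ^ 2 := by
  have := hr.1
  have := hr.2
  nlinarith

lemma evenKernel_pos (ha : 0 < a) (hr : r ∈ Ioo (0 : ℝ) 1) (x y : ℝ) :
    0 < evenKernel a r x y := by
  have h := one_sub_sq_pos hr
  have := hyp_pos ha (sq_nonneg (x * y * r / (1 - r ^ 2)))
  have := rpow_pos_of_pos h a
  unfold evenKernel
  positivity

lemma continuous_evenKernel (ha : 0 < a) (r x : ℝ) : Continuous (evenKernel a r x) := by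
  have := continuous_hyp ha
  unfold evenKernel
  fun_prop

/-- The kernel is quasiconcave in each variable on the half-line. -/
lemma min_evenKernel_le (ha : 0 < a) (hr : r ∈ Ioo (0 : ℝ) 1) (x : ℝ) {y₁ y₂ y₃ : ℝ}
    (h₀ : 0 ≤ y₁) (h₁₂ : y₁ ≤ y₂) (h₂₃ : y₂ ≤ y₃) :
    min (evenKernel a r x y₁) (evenKernel a r x y₃) ≤ evenKernel a r x y₂ := by
  have h := one_sub_sq_pos hr
  set d : ℝ := (x * r / (1 - r ^ 2)) ^ 2 with hd
  set b : ℝ := r ^ 2 / (1 - r ^ 2) with hb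
  have hd0 : 0 ≤ d := sq_nonneg _
  set φ : ℝ → ℝ := fun v => log (hyp a (d * v)) - b * v with hφ
  have hconc : ConcaveOn ℝ (Ici 0) φ := by
    refine ⟨convex_Ici 0, fun u hu v hv s t hs ht hst => ?_⟩
    have hu : 0 ≤ u := hu
    have hv : 0 ≤ v := hv
    have := (concaveOn_log_hyp ha).2 (show d * u ∈ Ici (0 : ℝ) from mul_nonneg hd0 hu)
      (show d * v ∈ Ici (0 : ℝ) from mul_nonneg hd0 hv) hs ht hst
    simp only [smul_eq_mul] at this
    simp only [hφ, smul_eq_mul]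
    rw [show d * (s * u + t * v) = s * (d * u) + t * (d * v) by ring]
    linarith
  have hK : ∀ y, evenKernel a r x y =
      (((1 - r ^ 2) ^ a)⁻¹ * exp (-x ^ 2 * b)) * exp (φ (y ^ 2)) := by
    intro y
    have hp := hyp_pos ha (mul_nonneg hd0 (sq_nonneg y))
    simp only [hφ, exp_sub, exp_log hp, evenKernel]
    rw [show (x * y * r / (1 - r ^ 2)) ^ 2 = d * y ^ 2 by rw [hd]; ring,
      show -(x ^ 2 + y ^ 2) * r ^ 2 / (1 - r ^ 2) = -x ^ 2 * b - b * y ^ 2 by rw [hb]; ring,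
      exp_sub]
    ring
  have hc : 0 ≤ ((1 - r ^ 2) ^ a)⁻¹ * exp (-x ^ 2 * b) := by
    have := rpow_pos_of_pos h a
    positivity
  have hsq₁ : y₁ ^ 2 ≤ y₂ ^ 2 := by gcongr
  have hsq₂ : y₂ ^ 2 ≤ y₃ ^ 2 := by gcongr; linarith
  have hmin : min (φ (y₁ ^ 2)) (φ (y₃ ^ 2)) ≤ φ (y₂ ^ 2) :=
    hconc.min_le_of_mem_Icc (sq_nonneg y₁) (sq_nonneg y₃) ⟨hsq₁, hsq₂⟩
  simp only [hK]
  rcases min_le_iff.mp hmin with h' | h'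
  · exact (min_le_left _ _).trans (by gcongr)
  · exact (min_le_right _ _).trans (by gcongr)

lemma bddAbove_evenKernel (ha : 0 < a) (hr : r ∈ Ioo (0 : ℝ) 1) {x : ℝ} (hx : 0 < x) :
    BddAbove (range (evenKernel a r x)) := by
  have h := one_sub_sq_pos hr
  have hr0 := hr.1
  set d : ℝ := (x * r / (1 - r ^ 2)) ^ 2 with hd
  set b : ℝ := r ^ 2 / (1 - r ^ 2) with hb
  have hd0 : 0 < d := by positivity
  have hb0 : 0 < b := by positivity
  refine ⟨((1 - r ^ 2) ^ a)⁻¹ * exp ((1 + 1 / a) * (d / b)), ?_⟩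
  rintro _ ⟨y, rfl⟩
  have h1 := hyp_le ha (N := d / b) (by positivity) (sq_nonneg (x * y * r / (1 - r ^ 2)))
  have h2 := rpow_pos_of_pos h a
  unfold evenKernel
  calc _ ≤ ((1 - r ^ 2) ^ a)⁻¹ * exp (-(x ^ 2 + y ^ 2) * r ^ 2 / (1 - r ^ 2)) *
        (exp ((1 + 1 / a) * (d / b)) * exp ((x * y * r / (1 - r ^ 2)) ^ 2 / (d / b))) := by
        gcongr
    _ = (((1 - r ^ 2) ^ a)⁻¹ * exp ((1 + 1 / a) * (d / b))) *
        (exp (-(x ^ 2 + y ^ 2) * r ^ 2 / (1 - r ^ 2)) *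
          exp ((x * y * r / (1 - r ^ 2)) ^ 2 / (d / b))) := by ring
    _ ≤ (((1 - r ^ 2) ^ a)⁻¹ * exp ((1 + 1 / a) * (d / b))) * 1 := by
        gcongr
        rw [← exp_add, exp_le_one_iff]
        have e : (x * y * r / (1 - r ^ 2)) ^ 2 / (d / b) = y ^ 2 * r ^ 2 / (1 - r ^ 2) := by
          rw [hd, hb]; field_simp
        rw [e, ← add_div]
        apply div_nonpos_of_nonpos_of_nonneg _ h.le
        nlinarith [mul_nonneg (sq_nonneg x) (sq_nonneg r)]
    _ = _ := mul_one _

/-- The kernel is positive definite. -/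
lemma two_mul_evenKernel_le (ha : 0 < a) (hr : r ∈ Ioo (0 : ℝ) 1) (x y : ℝ) :
    2 * evenKernel a r x y ≤ evenKernel a r x x + evenKernel a r y y := by
  have h := one_sub_sq_pos hr
  set q : ℝ := r / (1 - r ^ 2) with hq
  set e : ℝ → ℝ := fun x => exp (-x ^ 2 * r ^ 2 / (1 - r ^ 2)) with he
  have hsum : ∀ x y : ℝ, HasSum
      (fun m : ℕ => ((1 - r ^ 2) ^ a)⁻¹ * hypCoeff a m *
        ((e x * (x * x * q) ^ m) * (e y * (y * y * q) ^ m))) (evenKernel a r x y) := by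
    intro x y
    have := (summable_hyp_of_nonneg ha (sq_nonneg (x * y * r / (1 - r ^ 2)))).hasSum.mul_left
      (((1 - r ^ 2) ^ a)⁻¹ * exp (-(x ^ 2 + y ^ 2) * r ^ 2 / (1 - r ^ 2)))
    refine Eq.mpr (congrArg (fun u => HasSum u _) (funext fun m => ?_)) this
    rw [show -(x ^ 2 + y ^ 2) * r ^ 2 / (1 - r ^ 2) =
      -x ^ 2 * r ^ 2 / (1 - r ^ 2) + -y ^ 2 * r ^ 2 / (1 - r ^ 2) by ring, exp_add,
      show (x * y * r / (1 - r ^ 2)) ^ 2 = (x * x * q) * (y * y * q) by rw [hq]; ring, mul_pow]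
    simp only [he]
    ring
  refine hasSum_le (fun m => ?_) ((hsum x y).mul_left 2) ((hsum x x).add (hsum y y))
  have h1 := rpow_pos_of_pos h a
  have h2 := hypCoeff_pos ha m
  have h3 : 0 ≤ ((1 - r ^ 2) ^ a)⁻¹ * hypCoeff a m := by positivity
  nlinarith [mul_nonneg h3 (sq_nonneg (e x * (x * x * q) ^ m - e y * (y * y * q) ^ m))]

/-- If `p` is a better point than `x` for the kernel at `x`, the kernel at `p` is bounded below
between `x` and `p`. -/
lemma evenKernel_le_of_mem_uIcc (ha : 0 < a) (hr : r ∈ Ioo (0 : ℝ) 1) {x p t : ℝ}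
    (hx : 0 ≤ x) (hp : 0 ≤ p) (hxp : evenKernel a r x x ≤ evenKernel a r x p)
    (ht : t ∈ uIcc x p) : evenKernel a r x p ≤ evenKernel a r p t := by
  have h2 := two_mul_evenKernel_le ha hr x p
  have hpp : evenKernel a r x p ≤ evenKernel a r p p := by linarith
  have hpx := evenKernel_comm a r x p
  rcases le_total x p with h | h
  · rw [uIcc_of_le h] at ht
    refine le_trans (le_min hpx.le hpp) (min_evenKernel_le ha hr p hx ht.1 ht.2)
  · rw [uIcc_of_ge h] at ht
    refine le_trans (le_min hpp hpx.le) (min_evenKernel_le ha hr p hp ht.1 ht.2)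

lemma exists_almost_max_evenKernel (ha : 0 < a) (hr : r ∈ Ioo (0 : ℝ) 1) {x : ℝ} (hx : 0 < x) :
    ∃ p, 0 < p ∧ (∀ y, 0 < y → evenKernel a r x y ≤ 2 * evenKernel a r x p) ∧
      evenKernel a r x x ≤ evenKernel a r x p := by
  have hbdd : BddAbove (evenKernel a r x '' Ioi 0) :=
    (bddAbove_evenKernel ha hr hx).mono (image_subset_range _ _)
  have hle : ∀ y, 0 < y → evenKernel a r x y ≤ sSup (evenKernel a r x '' Ioi 0) :=
    fun y hy => le_csSup hbdd ⟨y, hy, rfl⟩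
  by_cases h : sSup (evenKernel a r x '' Ioi 0) ≤ 2 * evenKernel a r x x
  · exact ⟨x, hx, fun y hy => (hle y hy).trans h, le_rfl⟩
  · push Not at h
    have hS : sSup (evenKernel a r x '' Ioi 0) / 2 < sSup (evenKernel a r x '' Ioi 0) := by
      have := evenKernel_pos ha hr x x
      linarith
    obtain ⟨_, ⟨p, hp, rfl⟩, hlt⟩ := exists_lt_of_lt_csSup (nonempty_Ioi.image _) hS
    exact ⟨p, hp, fun y hy => by linarith [hle y hy], by linarith⟩

lemma setLIntegral_Ioi_pow_mul_gaussian {a b : ℝ} (ha : 0 < a) (hb : 0 < b) (m : ℕ) :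
    ∫⁻ y in Ioi (0 : ℝ), ENNReal.ofReal ((y ^ 2) ^ m * (y ^ (2 * a - 1) * exp (-b * y ^ 2))) =
      ENNReal.ofReal (b ^ (-(m + a)) * Gamma (m + a) / 2) := by
  have hq : (-1 : ℝ) < 2 * m + (2 * a - 1) := by
    have : (0 : ℝ) ≤ m := Nat.cast_nonneg m
    linarith
  have e : ∀ y ∈ Ioi (0 : ℝ), (y ^ 2) ^ m * (y ^ (2 * a - 1) * exp (-b * y ^ 2)) =
      y ^ (2 * m + (2 * a - 1)) * exp (-b * y ^ (2 : ℝ)) := by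
    intro y hy
    rw [rpow_add hy, rpow_two, ← pow_mul, ← rpow_natCast y]
    push_cast
    ring
  rw [setLIntegral_congr_fun measurableSet_Ioi (fun y hy => by
    simp only [e y hy]; rfl)]
  rw [← ofReal_integral_eq_lintegral_ofReal (integrableOn_rpow_mul_exp_neg_mul_rpow hq (by norm_num) hb),
    integral_rpow_mul_exp_neg_mul_rpow (by norm_num) hq hb]
  · congr 1
    rw [show (2 * (m : ℝ) + (2 * a - 1) + 1) / 2 = m + a by ring,
      show -(2 * (m : ℝ) + (2 * a - 1) + 1) / 2 = -(m + a) by ring]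
    ring
  · refine (ae_restrict_iff' measurableSet_Ioi).mpr (Filter.Eventually.of_forall fun y hy => ?_)
    have := rpow_pos_of_pos hy (2 * m + (2 * a - 1))
    simp only [Pi.zero_apply]
    positivity

/-- The kernel has constant mass. -/
lemma setLIntegral_evenKernel (ha : 0 < a) (hr : r ∈ Ioo (0 : ℝ) 1) (x : ℝ) :
    ∫⁻ y in Ioi (0 : ℝ), ENNReal.ofReal (evenKernel a r x y) *
      ENNReal.ofReal (|y| ^ (2 * a - 1) * exp (-y ^ 2)) = ENNReal.ofReal (Gamma a / 2) := by
  have h := one_sub_sq_pos hr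
  set b : ℝ := 1 / (1 - r ^ 2) with hb
  have hb0 : 0 < b := by positivity
  set s : ℝ := x ^ 2 * r ^ 2 / (1 - r ^ 2) with hs
  have hs0 : 0 ≤ s := by positivity
  set A : ℕ → ℝ := fun m => ((1 - r ^ 2) ^ a)⁻¹ * exp (-s) * hypCoeff a m *
    ((x * r / (1 - r ^ 2)) ^ 2) ^ m with hA
  have hA0 : ∀ m, 0 ≤ A m := by
    intro m
    have := rpow_pos_of_pos h a
    have := hypCoeff_pos ha m
    positivity
  have hexp : ∀ y ∈ Ioi (0 : ℝ), ENNReal.ofReal (evenKernel a r x y) *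
      ENNReal.ofReal (|y| ^ (2 * a - 1) * exp (-y ^ 2)) =
      ∑' m : ℕ, ENNReal.ofReal (A m) *
        ENNReal.ofReal ((y ^ 2) ^ m * (y ^ (2 * a - 1) * exp (-b * y ^ 2))) := by
    intro y hy
    have hy0 : 0 < y := hy
    have hyp0 := rpow_pos_of_pos hy0 (2 * a - 1)
    have hsum : HasSum (fun m : ℕ => A m * ((y ^ 2) ^ m * (y ^ (2 * a - 1) * exp (-b * y ^ 2))))
        (evenKernel a r x y * (|y| ^ (2 * a - 1) * exp (-y ^ 2))) := by
      have := ((summable_hyp_of_nonneg ha (sq_nonneg (x * y * r / (1 - r ^ 2)))).hasSum.mul_left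
        (((1 - r ^ 2) ^ a)⁻¹ * exp (-(x ^ 2 + y ^ 2) * r ^ 2 / (1 - r ^ 2)))).mul_right
        (|y| ^ (2 * a - 1) * exp (-y ^ 2))
      refine Eq.mpr (congrArg (fun u => HasSum u _) (funext fun m => ?_)) this
      have e1 : exp (-(x ^ 2 + y ^ 2) * r ^ 2 / (1 - r ^ 2)) * exp (-y ^ 2) =
          exp (-s) * exp (-b * y ^ 2) := by
        rw [← exp_add, ← exp_add, hs, hb]
        congr 1
        field_simp
        ring
      rw [abs_of_pos hy0, hA,
        show (x * y * r / (1 - r ^ 2)) ^ 2 = (x * r / (1 - r ^ 2)) ^ 2 * y ^ 2 by ring, mul_pow]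
      linear_combination (-((1 - r ^ 2) ^ a)⁻¹ * hypCoeff a m *
        (((x * r / (1 - r ^ 2)) ^ 2) ^ m * (y ^ 2) ^ m) * y ^ (2 * a - 1)) * e1
    have hnn : ∀ m : ℕ, 0 ≤ A m * ((y ^ 2) ^ m * (y ^ (2 * a - 1) * exp (-b * y ^ 2))) := by
      intro m
      have := hA0 m
      positivity
    rw [← ENNReal.ofReal_mul (evenKernel_pos ha hr x y).le, ← hsum.tsum_eq,
      ENNReal.ofReal_tsum_of_nonneg hnn hsum.summable]
    exact tsum_congr fun m => ENNReal.ofReal_mul (hA0 m)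
  rw [setLIntegral_congr_fun measurableSet_Ioi hexp, lintegral_tsum]
  · have hterm : ∀ m : ℕ, ∫⁻ y in Ioi (0 : ℝ), ENNReal.ofReal (A m) *
        ENNReal.ofReal ((y ^ 2) ^ m * (y ^ (2 * a - 1) * exp (-b * y ^ 2))) =
        ENNReal.ofReal (Gamma a / 2 * exp (-s) * (s ^ m / Nat.factorial m)) := by
      intro m
      have hma : (0 : ℝ) < m + a := by positivity
      rw [lintegral_const_mul' _ _ ENNReal.ofReal_ne_top, setLIntegral_Ioi_pow_mul_gaussian ha hb0,
        ← ENNReal.ofReal_mul (hA0 m)]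
      congr 1
      have hG := Gamma_pos_of_pos hma
      have e2 : b ^ (-(m + a)) = (1 - r ^ 2) ^ m * (1 - r ^ 2) ^ a := by
        rw [hb, one_div, inv_rpow h.le, ← rpow_neg h.le, neg_neg, rpow_add h, rpow_natCast]
      have e3 := rpow_pos_of_pos h a
      have e4 : ((x * r / (1 - r ^ 2)) ^ 2) ^ m * (1 - r ^ 2) ^ m = s ^ m := by
        rw [← mul_pow, hs]
        congr 1
        field_simp
      rw [e2, ← e4]
      simp only [hA, hypCoeff]
      field_simp
    simp only [hterm]
    rw [← ENNReal.ofReal_tsum_of_nonneg]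
    · have hG : HasSum (fun m : ℕ => s ^ m / Nat.factorial m) (exp s) := by
        rw [exp_eq_exp_ℝ]
        exact NormedSpace.expSeries_div_hasSum_exp s
      rw [(hG.mul_left _).tsum_eq, mul_assoc, ← exp_add, neg_add_cancel, exp_zero, mul_one]
    · intro m
      have := Gamma_pos_of_pos ha
      positivity
    · exact (summable_pow_div_factorial s).mul_left _
  · intro m
    exact Measurable.aemeasurable (by fun_prop)

end evenKernel

section genExp

variable {μ : ℝ}

lemma pow_div_genGamma_even (μ z : ℝ) (m : ℕ) :
    z ^ (2 * m) / genGamma μ (2 * m) = hypCoeff (μ + 1 / 2) m * ((z / 2) ^ 2) ^ m := by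
  have h2 : 2 * m / 2 = m := by omega
  rw [genGamma, if_pos (even_two_mul m), h2, hypCoeff, ← pow_mul, div_pow, ← add_assoc]
  field_simp

lemma pow_div_genGamma_odd (hμ : 0 < μ + 1 / 2) (z : ℝ) (m : ℕ) :
    z ^ (2 * m + 1) / genGamma μ (2 * m + 1) =
      hypCoeff (μ + 1 / 2) m * ((z / 2) ^ 2) ^ m * ((z / 2) / (m + (μ + 1 / 2))) := by
  have h2 : (2 * m + 1) / 2 = m := by omega
  have hma : (0 : ℝ) < m + (μ + 1 / 2) := by positivity
  have hG := Gamma_pos_of_pos hma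
  have hG' := Gamma_pos_of_pos hμ
  have e : Gamma ((m : ℝ) + μ + 3 / 2) = (m + (μ + 1 / 2)) * Gamma (m + (μ + 1 / 2)) := by
    rw [← Gamma_add_one hma.ne']; ring_nf
  rw [genGamma, if_neg (by simp), h2, hypCoeff, ← pow_mul, div_pow, e]
  field_simp
  ring

/-- The generalized exponential is controlled by its even part on the half-line. -/
lemma genExp_nonneg_and_le (hμ : 0 < μ + 1 / 2) {z : ℝ} (hz : 0 ≤ z) :
    0 ≤ genExp μ z ∧
      genExp μ z ≤ (1 + 2 * (1 + 1 / (μ + 1 / 2))) * hyp (μ + 1 / 2) ((z / 2) ^ 2) := by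
  set a := μ + 1 / 2 with ha
  set q := z / 2 with hq
  set κ := 1 + 1 / a with hκ
  have hκ1 : 1 ≤ κ := by
    have : 0 < 1 / a := by positivity
    linarith
  have hq0 : 0 ≤ q := by positivity
  set E : ℕ → ℝ := fun m => hypCoeff a m * (q ^ 2) ^ m with hE
  have hE0 : ∀ m, 0 ≤ E m := fun m => mul_nonneg (hypCoeff_pos hμ m).le (by positivity)
  have hsE : HasSum E (hyp a (q ^ 2)) := (summable_hyp_of_nonneg hμ (sq_nonneg q)).hasSum
  have hsE' : HasSum (fun m => E (m + 1)) (hyp a (q ^ 2) - 1) := by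
    have := (hasSum_nat_add_iff' (f := E) 1).mpr hsE
    simpa [hE, hypCoeff_zero hμ] using this
  have hodd0 : ∀ m : ℕ, 0 ≤ E m * (q / (m + a)) := fun m => mul_nonneg (hE0 m) (by positivity)
  have hodd : ∀ m : ℕ, E m * (q / (m + a)) ≤ κ * (E m + E (m + 1)) := by
    intro m
    have hu : (0 : ℝ) < m + a := by positivity
    have hv : (0 : ℝ) < m + 1 := by positivity
    have hsucc : E (m + 1) = E m * (q ^ 2 / ((m + 1) * (m + a))) := by
      simp only [hE]
      rw [hypCoeff_succ hμ, pow_succ (q ^ 2)]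
      field_simp
    have hle := succ_le_mul_add hμ m
    have hkey : q / (m + a) ≤ κ * (1 + q ^ 2 / ((m + 1) * (m + a))) := by
      have e : κ * (1 + q ^ 2 / ((m + 1) * (m + a))) =
          (κ * (m + a) * (m + 1) + κ * q ^ 2) / ((m + 1) * (m + a)) := by field_simp
      rw [e, div_le_div_iff₀ hu (by positivity)]
      have h1 : q * (m + 1) ≤ κ * (m + a) * (m + 1) + κ * q ^ 2 := by
        have h2 := mul_le_mul_of_nonneg_right hle hv.le
        have h3 := mul_le_mul_of_nonneg_right hκ1 (sq_nonneg q)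
        nlinarith [sq_nonneg (q - (m + 1)), mul_nonneg hq0 hv.le]
      calc q * (((m : ℝ) + 1) * (m + a)) = (q * (m + 1)) * (m + a) := by ring
        _ ≤ _ := by gcongr
    calc E m * (q / (m + a)) ≤ E m * (κ * (1 + q ^ 2 / ((m + 1) * (m + a)))) :=
          mul_le_mul_of_nonneg_left hkey (hE0 m)
      _ = κ * (E m + E (m + 1)) := by rw [hsucc]; ring
  have hsum := (hsE.add hsE').mul_left κ
  have hsodd : Summable fun m : ℕ => E m * (q / (m + a)) :=
    Summable.of_nonneg_of_le hodd0 hodd hsum.summable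
  have hle := hasSum_le hodd hsodd.hasSum hsum
  have heq : genExp μ z = hyp a (q ^ 2) + ∑' m : ℕ, E m * (q / (m + a)) := by
    have h1 : Summable fun m : ℕ => z ^ (2 * m) / genGamma μ (2 * m) := by
      simp only [pow_div_genGamma_even]
      exact hsE.summable
    have h2 : Summable fun m : ℕ => z ^ (2 * m + 1) / genGamma μ (2 * m + 1) := by
      simp only [pow_div_genGamma_odd hμ]
      exact hsodd
    rw [genExp, ← tsum_even_add_odd (f := fun m => z ^ m / genGamma μ m) h1 h2]
    simp only [pow_div_genGamma_even, pow_div_genGamma_odd hμ]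
    rfl
  have hF := hyp_pos hμ (sq_nonneg q)
  have hO : 0 ≤ ∑' m : ℕ, E m * (q / (m + a)) := tsum_nonneg hodd0
  rw [heq]
  constructor
  · positivity
  · nlinarith

end genExp

/-- The restriction of `lam μ` to the positive half-line. -/
noncomputable def lamPos (μ : ℝ) : Measure ℝ := (lam μ).restrict (Ioi 0)

lemma lintegral_lamPos (μ : ℝ) (g : ℝ → ENNReal) :
    ∫⁻ y, g y ∂lamPos μ = ∫⁻ y in Ioi (0 : ℝ),
      g y * ENNReal.ofReal (|y| ^ (2 * μ) * exp (-y ^ 2)) := by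
  rw [lamPos, lam, restrict_withDensity measurableSet_Ioi,
    lintegral_withDensity_eq_lintegral_mul_non_measurable]
  · simp only [Pi.mul_apply, mul_comm]
  · fun_prop
  · exact Filter.Eventually.of_forall fun y => ENNReal.ofReal_lt_top

lemma isFiniteMeasure_lamPos {μ : ℝ} (hμ : 0 < μ + 1 / 2) : IsFiniteMeasure (lamPos μ) := by
  constructor
  have h := setLIntegral_Ioi_pow_mul_gaussian hμ one_pos 0
  rw [← lintegral_one, lintegral_lamPos]
  refine lt_of_eq_of_lt ?_ (h ▸ ENNReal.ofReal_lt_top)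
  refine setLIntegral_congr_fun measurableSet_Ioi fun y hy => ?_
  simp only [one_mul, pow_zero, neg_mul, abs_of_pos (show 0 < y from hy)]
  rw [show 2 * (μ + 1 / 2) - 1 = 2 * μ by ring]

lemma lintegral_evenKernel_lamPos {μ r : ℝ} (hμ : 0 < μ + 1 / 2) (hr : r ∈ Ioo (0 : ℝ) 1) (x : ℝ) :
    ∫⁻ y, ENNReal.ofReal (evenKernel (μ + 1 / 2) r x y) ∂lamPos μ =
      ENNReal.ofReal (Gamma (μ + 1 / 2) / 2) := by
  rw [lintegral_lamPos, ← setLIntegral_evenKernel hμ hr x,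
    show 2 * (μ + 1 / 2) - 1 = 2 * μ by ring]

/-- The measure `|f| dλ` on the positive half-line. -/
noncomputable def lamPosWith (μ : ℝ) (f : ℝ → ℝ) : Measure ℝ :=
  (lamPos μ).withDensity fun y => ‖f y‖ₑ

lemma lamPosWith_univ_le (μ : ℝ) (f : ℝ → ℝ) :
    lamPosWith μ f univ ≤ ∫⁻ y, ‖f y‖ₑ ∂lam μ := by
  rw [lamPosWith, withDensity_apply _ MeasurableSet.univ, Measure.restrict_univ]
  exact setLIntegral_le_lintegral _ _

lemma lintegral_indicator_lamPos (μ : ℝ) (g : ℝ → ℝ) :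
    ∫⁻ y, ENNReal.ofReal ((Ioi (0 : ℝ)).indicator g y) ∂lamPos μ =
      ∫⁻ y, ENNReal.ofReal (g y) ∂lamPos μ :=
  setLIntegral_congr_fun measurableSet_Ioi fun y hy => by
    simp only [indicator_of_mem (show y ∈ Ioi (0 : ℝ) from hy)]

lemma ofReal_abs_Tplus_le {μ r : ℝ} (hμ : 0 < μ + 1 / 2) (hr : r ∈ Ioo (0 : ℝ) 1) {f : ℝ → ℝ}
    (hf : Integrable f (lam μ)) {x : ℝ} (hx : 0 < x) :
    ENNReal.ofReal |Tplus μ r f x| ≤ ENNReal.ofReal (1 + 2 * (1 + 1 / (μ + 1 / 2))) *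
      ∫⁻ y, ENNReal.ofReal ((Ioi (0 : ℝ)).indicator (evenKernel (μ + 1 / 2) r x) y)
        ∂lamPosWith μ f := by
  have h := one_sub_sq_pos hr
  have hr0 := hr.1
  have hk := continuous_evenKernel hμ r x
  have hpow := rpow_pos_of_pos h (μ + 1 / 2)
  have hfm : AEMeasurable (fun y => ‖f y‖ₑ) (lamPos μ) :=
    (hf.1.enorm).mono_measure Measure.restrict_le_self
  have hM : 0 ≤ 1 + 2 * (1 + 1 / (μ + 1 / 2)) := by positivity
  rw [lamPosWith, lintegral_withDensity_eq_lintegral_mul₀ hfm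
    (hk.measurable.indicator measurableSet_Ioi).ennreal_ofReal.aemeasurable]
  rw [lintegral_lamPos, ← lintegral_const_mul' _ _ ENNReal.ofReal_ne_top, Tplus, abs_mul,
    ENNReal.ofReal_mul (abs_nonneg _), abs_of_pos (inv_pos.mpr hpow), ← enorm_eq_ofReal_abs]
  refine (mul_le_mul_right (enorm_integral_le_lintegral_enorm _) _).trans ?_
  rw [← lintegral_const_mul' _ _ ENNReal.ofReal_ne_top]
  refine setLIntegral_mono' measurableSet_Ioi fun y hy => ?_
  have hy0 : 0 < y := hy
  obtain ⟨hg0, hg⟩ := genExp_nonneg_and_le hμ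
    (show 0 ≤ 2 * x * y * r / (1 - r ^ 2) by positivity)
  rw [show 2 * x * y * r / (1 - r ^ 2) / 2 = x * y * r / (1 - r ^ 2) by ring] at hg
  have hyp0 := rpow_pos_of_pos hy0 (2 * μ)
  rw [Pi.mul_apply, indicator_of_mem hy, abs_of_pos hy0, ← ofReal_norm,
    ← ofReal_norm,
    ← ENNReal.ofReal_mul (inv_pos.mpr hpow).le, ← ENNReal.ofReal_mul (norm_nonneg _),
    ← ENNReal.ofReal_mul (mul_nonneg (norm_nonneg _) (evenKernel_pos hμ hr x y).le),
    ← ENNReal.ofReal_mul hM]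
  refine ENNReal.ofReal_le_ofReal ?_
  rw [norm_mul, norm_mul, norm_mul, norm_mul, norm_of_nonneg (exp_pos _).le, norm_of_nonneg hg0,
    norm_of_nonneg hyp0.le, norm_of_nonneg (exp_pos _).le]
  calc _ ≤ ((1 - r ^ 2) ^ (μ + 1 / 2))⁻¹ * (exp (-(x ^ 2 + y ^ 2) * r ^ 2 / (1 - r ^ 2)) *
        ((1 + 2 * (1 + 1 / (μ + 1 / 2))) * hyp (μ + 1 / 2) ((x * y * r / (1 - r ^ 2)) ^ 2)) *
        ‖f y‖ * y ^ (2 * μ) * exp (-y ^ 2)) := by gcongr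
    _ = _ := by rw [evenKernel]; ring

lemma lintegral_evenKernel_le_of_notMem {μ r : ℝ} (hμ : 0 < μ + 1 / 2) (hr : r ∈ Ioo (0 : ℝ) 1)
    {f : ℝ → ℝ} (hf : Integrable f (lam μ)) {x : ℝ} (hx : 0 < x) {t : ENNReal} (ht : t ≠ ⊤)
    (hxV : x ∉ largeDensitySet (lamPos μ) (lamPosWith μ f) t) :
    ∫⁻ y, ENNReal.ofReal ((Ioi (0 : ℝ)).indicator (evenKernel (μ + 1 / 2) r x) y)
      ∂lamPosWith μ f ≤ 4 * t * ENNReal.ofReal (Gamma (μ + 1 / 2) / 2) := by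
  have := isFiniteMeasure_lamPos hμ
  have : IsFiniteMeasure (lamPosWith μ f) :=
    ⟨(lamPosWith_univ_le μ f).trans_lt hf.hasFiniteIntegral⟩
  obtain ⟨p, hp, hmax, hxp⟩ := exists_almost_max_evenKernel hμ hr hx
  set K := evenKernel (μ + 1 / 2) r with hK
  have hind : ∀ y, 0 < y → (Ioi (0 : ℝ)).indicator (K x) y = K x y :=
    fun y hy => indicator_of_mem (show y ∈ Ioi (0 : ℝ) from hy) _
  have hind0 : ∀ y, y ≤ 0 → (Ioi (0 : ℝ)).indicator (K x) y = 0 :=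
    fun y hy => indicator_of_notMem (not_lt.mpr hy) _
  have hpos : ∀ y, 0 ≤ (Ioi (0 : ℝ)).indicator (K x) y :=
    fun y => indicator_nonneg (fun y _ => (evenKernel_pos hμ hr x y).le) y
  refine lintegral_quasiconcave_le (p := p) (x := x)
    (fun J hJ hxJ => measure_le_of_notMem_largeDensitySet ht hxV hJ hxJ)
    ((continuous_evenKernel hμ r x).measurable.indicator measurableSet_Ioi) hpos ?_ ?_ ?_ ?_
  · intro c d e hcd hde
    rcases lt_or_ge 0 c with hc | hc
    · rw [hind c hc, hind d (hc.trans_le hcd), hind e (hc.trans_le (hcd.trans hde))]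
      exact min_evenKernel_le hμ hr x hc.le hcd hde
    · rw [hind0 c hc]
      exact (min_le_left _ _).trans (hpos d)
  · intro y
    rcases lt_or_ge 0 y with hy | hy
    · rw [hind y hy, hind p hp]
      exact hmax y hy
    · rw [hind0 y hy]
      exact mul_nonneg zero_le_two (hpos p)
  · rw [hind p hp, ← lintegral_evenKernel_lamPos hμ hr p, ← setLIntegral_const]
    refine le_trans (setLIntegral_mono' measurableSet_uIcc fun y hy => ?_)
      (setLIntegral_le_lintegral _ _)
    exact ENNReal.ofReal_le_ofReal (evenKernel_le_of_mem_uIcc hμ hr hx.le hp.le hxp hy)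
  · rw [lintegral_indicator_lamPos, lintegral_evenKernel_lamPos hμ hr x]

/-- Weak type (1,1) for T*_{μ,+} on (0,∞). -/
theorem TstarPlus_weak_type (μ : ℝ) (hμ : -1 / 2 < μ) :
    ∃ C : ℝ, 0 < C ∧ ∀ f : ℝ → ℝ, Integrable f (lam μ) → (∀ y, 0 ≤ f y) →
      ∀ η : ℝ, 0 < η →
        lam μ {x : ℝ | 0 < x ∧ η < TstarPlus μ f x} ≤
          ENNReal.ofReal (C / η * ∫ y, |f y| ∂(lam μ)) := by
  have ha : 0 < μ + 1 / 2 := by linarith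
  set M : ℝ := 1 + 2 * (1 + 1 / (μ + 1 / 2)) with hM
  set B : ℝ := Gamma (μ + 1 / 2) / 2 with hB
  have hM0 : 0 < M := by positivity
  have hB0 : 0 < B := half_pos (Gamma_pos_of_pos ha)
  refine ⟨8 * M * B, by positivity, fun f hf _ η hη => ?_⟩
  have := isFiniteMeasure_lamPos ha
  set t : ℝ := η / (4 * M * B) with ht
  have ht0 : 0 < t := by positivity
  set V := largeDensitySet (lamPos μ) (lamPosWith μ f) (ENNReal.ofReal t) with hV
  have hsub : {x : ℝ | 0 < x ∧ η < TstarPlus μ f x} ⊆ V ∩ Ioi 0 := by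
    rintro x ⟨hx, hηx⟩
    refine ⟨?_, hx⟩
    by_contra hxV
    have : Nonempty (Ioo (0 : ℝ) 1) := ⟨⟨1 / 2, by norm_num, by norm_num⟩⟩
    obtain ⟨r, hr⟩ := exists_lt_of_lt_ciSup hηx
    have h1 := ofReal_abs_Tplus_le ha r.2 hf hx
    have h2 := lintegral_evenKernel_le_of_notMem ha r.2 hf hx ENNReal.ofReal_ne_top hxV
    have h3 := h1.trans (mul_le_mul_right h2 _)
    rw [← ENNReal.ofReal_ofNat, ← ENNReal.ofReal_mul (by norm_num),
      ← ENNReal.ofReal_mul (by positivity), ← ENNReal.ofReal_mul hM0.le,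
      ENNReal.ofReal_le_ofReal_iff (by positivity), ← hB] at h3
    have e : M * (4 * t * B) = η := by rw [ht]; field_simp
    linarith
  have hVm : MeasurableSet V := (isOpen_biUnion fun i _ => isOpen_Ioo).measurableSet
  have hle : lam μ {x : ℝ | 0 < x ∧ η < TstarPlus μ f x} ≤ lamPos μ V := by
    rw [lamPos, Measure.restrict_apply hVm]
    exact measure_mono hsub
  have hmain := (mul_measure_largeDensitySet_le (lamPos μ) (lamPosWith μ f)
    (ENNReal.ofReal t)).trans (mul_le_mul_right (lamPosWith_univ_le μ f) 2)
  have hint : ∫⁻ y, ‖f y‖ₑ ∂lam μ = ENNReal.ofReal (∫ y, |f y| ∂lam μ) :=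
    (ofReal_integral_norm_eq_lintegral_enorm hf).symm
  rw [hint, ← ENNReal.ofReal_ofNat, ← ENNReal.ofReal_mul (by norm_num)] at hmain
  have e : 8 * M * B / η * ∫ y, |f y| ∂lam μ = t⁻¹ * (2 * ∫ y, |f y| ∂lam μ) := by
    rw [ht]; field_simp; ring
  rw [e, ENNReal.ofReal_mul (inv_pos.mpr ht0).le, ENNReal.ofReal_inv_of_pos ht0]
  refine hle.trans ?_
  calc lamPos μ V = (ENNReal.ofReal t)⁻¹ * (ENNReal.ofReal t * lamPos μ V) := by
        rw [← mul_assoc, ENNReal.inv_mul_cancel (by simpa using ht0) ENNReal.ofReal_ne_top, one_mul]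
    _ ≤ _ := by gcongr
end

section
/- Suppose -1/2 < μ < 0. There exists a constant C > 0 such that for every x > 0 and every 0 < r < 1, ∫_0^∞ (1-r²)^{-(μ+1/2)} e^{-(rx-y)²/(1-r²)} (1 + 2|rx-y| y/(1-r²))^{-μ} y^{2μ} dy ≤ C. -/
open MeasureTheory Real Set

/-- Pointwise bound, uniform in `a`, for the rescaled integrand. -/
lemma rescaled_integrand_le {μ : ℝ} (hμ1 : -1 / 2 < μ) (hμ2 : μ < 0) (a : ℝ) {t : ℝ}
    (ht : 0 < t) :
    exp (-(a - t) ^ 2) * (1 + 2 * |a - t| * t) ^ (-μ) * t ^ (2 * μ) ≤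
      3 * (Ioc (0 : ℝ) 1).indicator (fun t => t ^ (2 * μ)) t +
        3 * exp (-(1 / 2) * (t - a) ^ 2) := by
  set u := |a - t| with hu
  have hu0 : 0 ≤ u := abs_nonneg _
  have hsq : (a - t) ^ 2 = u ^ 2 := (sq_abs _).symm
  have hsq' : (t - a) ^ 2 = u ^ 2 := by rw [← hsq]; ring
  rw [hsq, hsq']
  have hlin : 1 + 2 * u ≤ 3 * exp (1 / 2 * u ^ 2) := by
    nlinarith [add_one_le_exp (1 / 2 * u ^ 2), sq_nonneg (u - 2)]
  have hexp : exp (-u ^ 2) * (1 + 2 * u) ≤ 3 * exp (-(1 / 2) * u ^ 2) := by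
    calc exp (-u ^ 2) * (1 + 2 * u) ≤ exp (-u ^ 2) * (3 * exp (1 / 2 * u ^ 2)) := by gcongr
      _ = 3 * (exp (-u ^ 2) * exp (1 / 2 * u ^ 2)) := by ring
      _ = 3 * exp (-(1 / 2) * u ^ 2) := by rw [← exp_add]; ring_nf
  have hpow : (1 + 2 * u) ^ (-μ) ≤ 1 + 2 * u :=
    rpow_le_self_of_one_le (by linarith) (by linarith)
  have htpos : 0 < t ^ (2 * μ) := rpow_pos_of_pos ht _
  rcases le_or_gt t 1 with h1 | h1
  · rw [indicator_of_mem (mem_Ioc.2 ⟨ht, h1⟩)]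
    have hle : (1 + 2 * u * t) ^ (-μ) ≤ (1 + 2 * u) ^ (-μ) :=
      rpow_le_rpow (by positivity) (by nlinarith) (by linarith)
    have hexp1 : exp (-(1 / 2) * u ^ 2) ≤ 1 := exp_le_one_iff.2 (by nlinarith [sq_nonneg u])
    calc exp (-u ^ 2) * (1 + 2 * u * t) ^ (-μ) * t ^ (2 * μ)
        ≤ exp (-u ^ 2) * (1 + 2 * u) * t ^ (2 * μ) := by gcongr; exact hle.trans hpow
      _ ≤ 3 * t ^ (2 * μ) := by gcongr; linarith
      _ ≤ _ := le_add_of_nonneg_right (by positivity)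
  · rw [indicator_of_notMem (fun h => not_le.2 h1 (mem_Ioc.1 h).2), mul_zero, zero_add]
    have hle : (1 + 2 * u * t) ^ (-μ) ≤ (1 + 2 * u) ^ (-μ) * t ^ (-μ) := by
      rw [← mul_rpow (by positivity) ht.le]
      exact rpow_le_rpow (by positivity) (by nlinarith) (by linarith)
    have ht1 : t ^ (-μ) * t ^ (2 * μ) ≤ 1 := by
      rw [← rpow_add ht]
      exact rpow_le_one_of_one_le_of_nonpos h1.le (by linarith)
    calc exp (-u ^ 2) * (1 + 2 * u * t) ^ (-μ) * t ^ (2 * μ)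
        ≤ exp (-u ^ 2) * ((1 + 2 * u) ^ (-μ) * t ^ (-μ)) * t ^ (2 * μ) := by gcongr
      _ = exp (-u ^ 2) * (1 + 2 * u) ^ (-μ) * (t ^ (-μ) * t ^ (2 * μ)) := by ring
      _ ≤ exp (-u ^ 2) * (1 + 2 * u) * 1 := by gcongr
      _ ≤ _ := by rw [mul_one]; exact hexp

/-- The substitution `y = s t` in the integrand. -/
lemma integrand_comp_mul {μ s t b : ℝ} (hs : 0 < s) (ht : 0 < t) :
    s * (((s ^ 2) ^ (μ + 1 / 2))⁻¹ * exp (-(b - s * t) ^ 2 / s ^ 2) *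
      (1 + 2 * |b - s * t| * (s * t) / s ^ 2) ^ (-μ) * (s * t) ^ (2 * μ)) =
    exp (-(b / s - t) ^ 2) * (1 + 2 * |b / s - t| * t) ^ (-μ) * t ^ (2 * μ) := by
  have hb : b - s * t = s * (b / s - t) := by field_simp
  have hexp : -(s * (b / s - t)) ^ 2 / s ^ 2 = -(b / s - t) ^ 2 := by
    generalize b / s - t = w
    field_simp
  have habs : 2 * |s * (b / s - t)| * (s * t) / s ^ 2 = 2 * |b / s - t| * t := by
    rw [abs_mul, abs_of_pos hs]
    generalize |b / s - t| = w
    field_simp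
  have hpow : s * ((s ^ 2) ^ (μ + 1 / 2))⁻¹ * s ^ (2 * μ) = 1 := by
    have h2 : (s ^ 2) ^ (μ + 1 / 2) = s * s ^ (2 * μ) := by
      rw [← rpow_natCast, ← rpow_mul hs.le, show ((2 : ℕ) : ℝ) * (μ + 1 / 2) = 1 + 2 * μ by
        push_cast; ring, rpow_add hs, rpow_one]
    have : 0 < s ^ (2 * μ) := rpow_pos_of_pos hs _
    rw [h2]
    field_simp
  rw [hb, hexp, habs, mul_rpow hs.le ht.le]
  linear_combination (exp (-(b / s - t) ^ 2) * (1 + 2 * |b / s - t| * t) ^ (-μ) *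
    t ^ (2 * μ)) * hpow

/-- Uniform bound of an integral appearing in the L^∞ estimate, for -1/2 < μ < 0. -/
theorem Linfty_integral_bound (μ : ℝ) (hμ1 : -1 / 2 < μ) (hμ2 : μ < 0) :
    ∃ C : ℝ, 0 < C ∧ ∀ x : ℝ, 0 < x → ∀ r : ℝ, 0 < r → r < 1 →
      (∫ y in Set.Ioi (0 : ℝ),
          ((1 - r ^ 2) ^ (μ + 1 / 2))⁻¹ * Real.exp (-(r * x - y) ^ 2 / (1 - r ^ 2)) *
            (1 + 2 * |r * x - y| * y / (1 - r ^ 2)) ^ (-μ) * y ^ (2 * μ)) ≤ C := by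
  set p : ℝ → ℝ := (Ioc (0 : ℝ) 1).indicator (fun t => t ^ (2 * μ)) with hp
  have hp0 : ∀ t, 0 ≤ p t := fun t => indicator_nonneg (fun t ht => rpow_nonneg ht.1.le _) t
  have hpi : Integrable p := by
    rw [hp, integrable_indicator_iff measurableSet_Ioc,
      ← intervalIntegrable_iff_integrableOn_Ioc_of_le zero_le_one]
    exact intervalIntegral.intervalIntegrable_rpow' (by linarith)
  set q : ℝ → ℝ := fun t => exp (-(1 / 2) * t ^ 2) with hq
  have hq0 : ∀ t, 0 ≤ q t := fun t => (exp_pos _).le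
  have hqi : Integrable q := integrable_exp_neg_mul_sq (by norm_num)
  have hp_int : 0 ≤ ∫ t, p t := integral_nonneg hp0
  have hq_int : 0 ≤ ∫ t, q t := integral_nonneg hq0
  refine ⟨3 * (∫ t, p t) + 3 * (∫ t, q t) + 1, by positivity, fun x hx r hr0 hr1 => ?_⟩
  have hpos : 0 < 1 - r ^ 2 := by nlinarith
  obtain ⟨s, hs, hs2⟩ : ∃ s : ℝ, 0 < s ∧ 1 - r ^ 2 = s ^ 2 :=
    ⟨√(1 - r ^ 2), sqrt_pos.2 hpos, (sq_sqrt hpos.le).symm⟩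
  rw [hs2]
  set g : ℝ → ℝ := fun y => ((s ^ 2) ^ (μ + 1 / 2))⁻¹ * exp (-(r * x - y) ^ 2 / s ^ 2) *
    (1 + 2 * |r * x - y| * y / s ^ 2) ^ (-μ) * y ^ (2 * μ) with hg
  set a := r * x / s
  have hqa : Integrable (fun t => q (t - a)) := hqi.comp_sub_right a
  have hFi : Integrable (fun t => 3 * p t + 3 * q (t - a)) :=
    (hpi.const_mul 3).add (hqa.const_mul 3)
  have hscale : ∫ y in Ioi (0 : ℝ), g y = ∫ t in Ioi (0 : ℝ), s * g (s * t) := by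
    rw [integral_const_mul, integral_comp_mul_left_Ioi g 0 hs, mul_zero, smul_eq_mul,
      mul_inv_cancel_left₀ hs.ne']
  calc ∫ y in Ioi (0 : ℝ), g y = ∫ t in Ioi (0 : ℝ), s * g (s * t) := hscale
    _ ≤ ∫ t in Ioi (0 : ℝ), (3 * p t + 3 * q (t - a)) := by
      refine integral_mono_of_nonneg ?_ hFi.integrableOn ?_
      · filter_upwards [ae_restrict_mem measurableSet_Ioi] with t ht
        have ht' : 0 < t := ht
        simp only [hg, Pi.zero_apply]
        positivity
      · filter_upwards [ae_restrict_mem measurableSet_Ioi] with t ht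
        exact (integrand_comp_mul hs ht).le.trans (rescaled_integrand_le hμ1 hμ2 a ht)
    _ ≤ ∫ t, (3 * p t + 3 * q (t - a)) :=
      setIntegral_le_integral hFi (.of_forall fun t => by
        have := hp0 t
        have := hq0 (t - a)
        simp only [Pi.zero_apply]
        positivity)
    _ = 3 * (∫ t, p t) + 3 * ∫ t, q t := by
      rw [integral_add (hpi.const_mul 3) (hqa.const_mul 3), integral_const_mul,
        integral_const_mul, integral_sub_right_eq_self q a]
    _ ≤ _ := by linarith
end
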